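/- Let Γ be a Jordan C¹-curve in the plane (a connected closed one-dimensional C¹-submanifold of ℝ², equivalently the image of an injective C¹ immersion of S¹), and let T be a non-flat triangle. Then there exist a ∈ ℝ with a > 0 and b ∈ ℂ such that the three vertices of a·T + b all lie on Γ. -/

import Mathlib

open Finset in
/-- A discrete degree computation in the plane: two labellings of a grid with prescribed values
on opposite sides have total degree one. -/
theorem sum_grid_two (m : ℕ) (b c : ℕ → ℕ → ℤ)
    (hb0 : ∀ j, b 0 j = 0) (hb1 : ∀ j, b m j = 1)
    (hc0 : ∀ i, c i 0 = 0) (hc1 : ∀ i, c i m = 1) :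
    ∑ i ∈ range m, ∑ j ∈ range m,
      ((b (i + 1) j - b i j) * (c (i + 1) (j + 1) - c (i + 1) j)
        - (b i (j + 1) - b i j) * (c (i + 1) (j + 1) - c i (j + 1))) = 1 := by
  let P : ℕ → ℕ → ℤ := fun i j => b i j * (c i (j + 1) - c i j)
  let Q : ℕ → ℕ → ℤ := fun i j => b i j * (c (i + 1) j - c i j)
  have key : ∀ i j, (b (i + 1) j - b i j) * (c (i + 1) (j + 1) - c (i + 1) j)
        - (b i (j + 1) - b i j) * (c (i + 1) (j + 1) - c i (j + 1))
      = (P (i + 1) j - P i j) - (Q i (j + 1) - Q i j) := by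
    intro i j
    simp only [P, Q]
    ring
  have hQ : ∀ i, ∑ j ∈ range m, (Q i (j + 1) - Q i j) = 0 := by
    intro i
    rw [sum_range_sub (fun j => Q i j)]
    simp [Q, hc0, hc1]
  have hP : ∑ i ∈ range m, ∑ j ∈ range m, (P (i + 1) j - P i j) = 1 := by
    simp_rw [sum_sub_distrib]
    rw [← sum_sub_distrib, sum_range_sub (fun i => ∑ j ∈ range m, P i j)]
    simp only [P, hb0, hb1, zero_mul, one_mul, sum_const_zero, sub_zero]
    rw [sum_range_sub (fun j => c m j), hc0, hc1, sub_zero]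
  calc _ = ∑ i ∈ range m, (∑ j ∈ range m, (P (i + 1) j - P i j)
        - ∑ j ∈ range m, (Q i (j + 1) - Q i j)) := by
        simp_rw [key, ← sum_sub_distrib]
    _ = 1 := by simp_rw [hQ, sub_zero, hP]

open Finset in
/-- If three labellings of a cubical grid are `0` and `1` on the respective pairs of opposite
faces, then some cell of the grid is labelled non-constantly by all three of them. -/
theorem exists_cell_not_constant (m : ℕ) (a b c : ℕ → ℕ → ℕ → ℤ)
    (ha0 : ∀ j k, a 0 j k = 0) (ha1 : ∀ j k, a m j k = 1)
    (hb0 : ∀ i k, b i 0 k = 0) (hb1 : ∀ i k, b i m k = 1)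
    (hc0 : ∀ i j, c i j 0 = 0) (hc1 : ∀ i j, c i j m = 1) :
    ∃ i < m, ∃ j < m, ∃ k < m,
      (∃ u ≤ 1, ∃ v ≤ 1, ∃ w ≤ 1, a (i + u) (j + v) (k + w) ≠ a i j k) ∧
      (∃ u ≤ 1, ∃ v ≤ 1, ∃ w ≤ 1, b (i + u) (j + v) (k + w) ≠ b i j k) ∧
      (∃ u ≤ 1, ∃ v ≤ 1, ∃ w ≤ 1, c (i + u) (j + v) (k + w) ≠ c i j k) := by
  let P : ℕ → ℕ → ℕ → ℤ := fun i j k => a i j k *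
    ((b i (j + 1) k - b i j k) * (c i (j + 1) (k + 1) - c i (j + 1) k)
      - (b i j (k + 1) - b i j k) * (c i (j + 1) (k + 1) - c i j (k + 1)))
  let Q : ℕ → ℕ → ℕ → ℤ := fun i j k => a i j k *
    ((b (i + 1) j k - b i j k) * (c (i + 1) j (k + 1) - c (i + 1) j k)
      - (b i j (k + 1) - b i j k) * (c (i + 1) j (k + 1) - c i j (k + 1)))
  let R : ℕ → ℕ → ℕ → ℤ := fun i j k => a i j k *
    ((b (i + 1) j k - b i j k) * (c (i + 1) (j + 1) k - c (i + 1) j k)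
      - (b i (j + 1) k - b i j k) * (c (i + 1) (j + 1) k - c i (j + 1) k))
  let D : ℕ → ℕ → ℕ → ℤ := fun i j k =>
    (P (i + 1) j k - P i j k) - (Q i (j + 1) k - Q i j k) + (R i j (k + 1) - R i j k)
  have hP : ∑ i ∈ range m, ∑ j ∈ range m, ∑ k ∈ range m, (P (i + 1) j k - P i j k) = 1 := by
    simp_rw [sum_sub_distrib]
    rw [← sum_sub_distrib, sum_range_sub (fun i => ∑ j ∈ range m, ∑ k ∈ range m, P i j k)]
    have h0 : ∑ j ∈ range m, ∑ k ∈ range m, P 0 j k = 0 := by simp [P, ha0]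
    have h1 : ∑ j ∈ range m, ∑ k ∈ range m, P m j k = 1 := by
      simp only [P, ha1, one_mul]
      exact sum_grid_two m (b m) (c m) (hb0 m) (hb1 m) (hc0 m) (hc1 m)
    rw [h0, h1, sub_zero]
  have hQ : ∀ i, ∑ j ∈ range m, ∑ k ∈ range m, (Q i (j + 1) k - Q i j k) = 0 := by
    intro i
    simp_rw [sum_sub_distrib]
    rw [← sum_sub_distrib, sum_range_sub (fun j => ∑ k ∈ range m, Q i j k)]
    simp [Q, hb0, hb1]
  have hR : ∀ i j, ∑ k ∈ range m, (R i j (k + 1) - R i j k) = 0 := by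
    intro i j
    rw [sum_range_sub (fun k => R i j k)]
    simp [R, hc0, hc1]
  have hD : ∑ i ∈ range m, ∑ j ∈ range m, ∑ k ∈ range m, D i j k = 1 := by
    calc _ = ∑ i ∈ range m, (∑ j ∈ range m, ∑ k ∈ range m, (P (i + 1) j k - P i j k)
          - ∑ j ∈ range m, ∑ k ∈ range m, (Q i (j + 1) k - Q i j k)
          + ∑ j ∈ range m, ∑ k ∈ range m, (R i j (k + 1) - R i j k)) := by
          simp_rw [← sum_sub_distrib, ← sum_add_distrib, D]
      _ = 1 := by simp_rw [hQ, hR, sum_const_zero, sub_zero, add_zero, hP]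
  have hne : ∃ i ∈ range m, ∃ j ∈ range m, ∃ k ∈ range m, D i j k ≠ 0 := by
    by_contra! h
    rw [sum_eq_zero fun i hi => sum_eq_zero fun j hj => sum_eq_zero fun k hk =>
      h i hi j hj k hk] at hD
    exact zero_ne_one hD
  obtain ⟨i, hi, j, hj, k, hk, h⟩ := hne
  refine ⟨i, mem_range.1 hi, j, mem_range.1 hj, k, mem_range.1 hk, ?_, ?_, ?_⟩ <;>
  · by_contra! hcon
    refine h ?_
    have h001 := hcon 0 zero_le_one 0 zero_le_one 1 le_rfl
    have h010 := hcon 0 zero_le_one 1 le_rfl 0 zero_le_one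
    have h011 := hcon 0 zero_le_one 1 le_rfl 1 le_rfl
    have h100 := hcon 1 le_rfl 0 zero_le_one 0 zero_le_one
    have h101 := hcon 1 le_rfl 0 zero_le_one 1 le_rfl
    have h110 := hcon 1 le_rfl 1 le_rfl 0 zero_le_one
    have h111 := hcon 1 le_rfl 1 le_rfl 1 le_rfl
    simp only [add_zero] at h001 h010 h011 h100 h101 h110
    simp only [D, P, Q, R, h001, h010, h011, h100, h101, h110, h111]
    ring

/-- The Poincaré–Miranda theorem on the unit cube, with strict boundary conditions. -/
theorem exists_common_zero_of_cube (f g h : ℝ × ℝ × ℝ → ℝ)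
    (hf : Continuous f) (hg : Continuous g) (hh : Continuous h)
    (hf0 : ∀ y ∈ Set.Icc (0 : ℝ) 1, ∀ z ∈ Set.Icc (0 : ℝ) 1, f (0, y, z) < 0)
    (hf1 : ∀ y ∈ Set.Icc (0 : ℝ) 1, ∀ z ∈ Set.Icc (0 : ℝ) 1, 0 < f (1, y, z))
    (hg0 : ∀ x ∈ Set.Icc (0 : ℝ) 1, ∀ z ∈ Set.Icc (0 : ℝ) 1, g (x, 0, z) < 0)
    (hg1 : ∀ x ∈ Set.Icc (0 : ℝ) 1, ∀ z ∈ Set.Icc (0 : ℝ) 1, 0 < g (x, 1, z))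
    (hh0 : ∀ x ∈ Set.Icc (0 : ℝ) 1, ∀ y ∈ Set.Icc (0 : ℝ) 1, h (x, y, 0) < 0)
    (hh1 : ∀ x ∈ Set.Icc (0 : ℝ) 1, ∀ y ∈ Set.Icc (0 : ℝ) 1, 0 < h (x, y, 1)) :
    ∃ p ∈ Set.Icc (0 : ℝ × ℝ × ℝ) 1, f p = 0 ∧ g p = 0 ∧ h p = 0 := by
  have hK : IsCompact (Set.Icc (0 : ℝ × ℝ × ℝ) 1) := isCompact_Icc
  obtain ⟨p, hp, hmin⟩ := hK.exists_isMinOn (f := fun p => |f p| + |g p| + |h p|)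
    ⟨0, Set.left_mem_Icc.2 zero_le_one⟩ (by fun_prop)
  rw [isMinOn_iff] at hmin
  set e := |f p| + |g p| + |h p|
  by_cases he0 : e = 0
  · refine ⟨p, hp, ?_, ?_, ?_⟩ <;> rw [← abs_nonpos_iff] <;>
      linarith [abs_nonneg (f p), abs_nonneg (g p), abs_nonneg (h p)]
  exfalso
  have hepos : 0 < e := lt_of_le_of_ne (by positivity) (Ne.symm he0)
  have unif : ∀ φ : ℝ × ℝ × ℝ → ℝ, Continuous φ → ∃ d > 0, ∀ x ∈ Set.Icc (0 : ℝ × ℝ × ℝ) 1,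
      ∀ y ∈ Set.Icc (0 : ℝ × ℝ × ℝ) 1, dist x y < d → dist (φ x) (φ y) < e / 3 := fun φ hφ =>
    Metric.uniformContinuousOn_iff.1 (hK.uniformContinuousOn_of_continuous hφ.continuousOn)
      (e / 3) (by positivity)
  obtain ⟨d₁, hd₁, hfu⟩ := unif f hf
  obtain ⟨d₂, hd₂, hgu⟩ := unif g hg
  obtain ⟨d₃, hd₃, hhu⟩ := unif h hh
  obtain ⟨n, hn⟩ := exists_nat_one_div_lt (lt_min hd₁ (lt_min hd₂ hd₃))
  rw [lt_min_iff, lt_min_iff] at hn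
  let m : ℕ := n + 1
  have hm : (0 : ℝ) < m := by positivity
  have hmm : (m : ℝ) / m = 1 := div_self hm.ne'
  let q : ℕ → ℕ → ℕ → ℝ × ℝ × ℝ := fun i j k => ((i : ℝ) / m, (j : ℝ) / m, (k : ℝ) / m)
  have hq : ∀ i ≤ m, ∀ j ≤ m, ∀ k ≤ m, q i j k ∈ Set.Icc (0 : ℝ × ℝ × ℝ) 1 := by
    intro i hi j hj k hk
    have : ∀ l ≤ m, 0 ≤ (l : ℝ) / m ∧ (l : ℝ) / m ≤ 1 := fun l hl =>
      ⟨by positivity, (div_le_one hm).2 (by exact_mod_cast hl)⟩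
    exact ⟨⟨(this i hi).1, (this j hj).1, (this k hk).1⟩,
      ⟨(this i hi).2, (this j hj).2, (this k hk).2⟩⟩
  have hq_dist : ∀ i j k, ∀ u ≤ 1, ∀ v ≤ 1, ∀ w ≤ 1,
      dist (q (i + u) (j + v) (k + w)) (q i j k) ≤ 1 / m := by
    have : ∀ l t : ℕ, t ≤ 1 → dist (((l + t : ℕ) : ℝ) / m) ((l : ℝ) / m) ≤ 1 / m := by
      intro l t ht
      rw [Real.dist_eq, ← sub_div, Nat.cast_add, add_sub_cancel_left, abs_of_nonneg (by positivity)]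
      gcongr
      exact_mod_cast ht
    intro i j k u hu v hv w hw
    exact max_le (this i u hu) (max_le (this j v hv) (this k w hw))
  -- labels are computed after clamping indices to the grid
  let lab : (ℝ × ℝ × ℝ → ℝ) → ℕ → ℕ → ℕ → ℤ := fun φ i j k =>
    if 0 < φ (q (min i m) (min j m) (min k m)) then 1 else 0
  have hcl : ∀ l : ℕ, ((min l m : ℕ) : ℝ) / m ∈ Set.Icc (0 : ℝ) 1 := fun l =>
    ⟨by positivity, (div_le_one hm).2 (by exact_mod_cast min_le_right l m)⟩
  obtain ⟨i, hi, j, hj, k, hk, hfc, hgc, hhc⟩ := exists_cell_not_constant m (lab f) (lab g) (lab h)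
    (fun j k => if_neg (by simpa [q] using (hf0 _ (hcl j) _ (hcl k)).le))
    (fun j k => if_pos (by simpa [q, hmm] using hf1 _ (hcl j) _ (hcl k)))
    (fun i k => if_neg (by simpa [q] using (hg0 _ (hcl i) _ (hcl k)).le))
    (fun i k => if_pos (by simpa [q, hmm] using hg1 _ (hcl i) _ (hcl k)))
    (fun i j => if_neg (by simpa [q] using (hh0 _ (hcl i) _ (hcl j)).le))
    (fun i j => if_pos (by simpa [q, hmm] using hh1 _ (hcl i) _ (hcl j)))
  have small : ∀ φ : ℝ × ℝ × ℝ → ℝ, ∀ d > 1 / (m : ℝ),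
      (∀ x ∈ Set.Icc (0 : ℝ × ℝ × ℝ) 1, ∀ y ∈ Set.Icc (0 : ℝ × ℝ × ℝ) 1,
        dist x y < d → dist (φ x) (φ y) < e / 3) →
      (∃ u ≤ 1, ∃ v ≤ 1, ∃ w ≤ 1, lab φ (i + u) (j + v) (k + w) ≠ lab φ i j k) →
      |φ (q i j k)| < e / 3 := by
    rintro φ d hd hφ ⟨u, hu, v, hv, w, hw, hne⟩
    have h1 := hφ _ (hq (i + u) (by omega) (j + v) (by omega) (k + w) (by omega)) _
      (hq i hi.le j hj.le k hk.le) ((hq_dist i j k u hu v hv w hw).trans_lt hd)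
    have e1 : min (i + u) m = i + u := by omega
    have e2 : min (j + v) m = j + v := by omega
    have e3 : min (k + w) m = k + w := by omega
    simp only [lab, e1, e2, e3, min_eq_left hi.le, min_eq_left hj.le, min_eq_left hk.le] at hne
    rw [Real.dist_eq, abs_lt] at h1
    rw [abs_lt]
    split_ifs at hne with h2 h3 h3
    · exact absurd rfl hne
    · constructor <;> linarith
    · constructor <;> linarith
    · exact absurd rfl hne
  have hm' : (m : ℝ) = n + 1 := by simp [m]
  have h1 := small f d₁ (by rw [hm']; exact hn.1) hfu hfc
  have h2 := small g d₂ (by rw [hm']; exact hn.2.1) hgu hgc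
  have h3 := small h d₃ (by rw [hm']; exact hn.2.2) hhu hhc
  linarith [hmin _ (hq i hi.le j hj.le k hk.le)]

/-- Let `θ (s, δ)` be a continuous choice of the direction of the chord from the parameter `s` to
the parameter `s + δ` of a closed curve of period one, normalized so that reversing a chord adds
`π`. Then any triple of directions of the sides of a positively oriented triangle is realized by
three points on the curve. -/
theorem exists_chord_angles (θ : ℝ × ℝ → ℝ) (hθ : Continuous θ)
    (hflip : ∀ s, ∀ δ ∈ Set.Icc (0 : ℝ) 1, θ (s + δ, 1 - δ) = θ (s, δ) + Real.pi)
    (α₀ α₁ α₂ : ℝ) (h₀₁ : α₁ - α₀ < Real.pi) (h₁₂ : α₂ - α₁ < Real.pi)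
    (h₀₂ : Real.pi < α₂ - α₀) :
    ∃ s x y : ℝ, 0 < x ∧ 0 < y ∧ x + y < 1 ∧
      θ (s, x) = α₀ ∧ θ (s + x, y) = α₁ ∧ θ (s, x + y) + Real.pi = α₂ := by
  have hper : ∀ s, ∀ δ ∈ Set.Icc (0 : ℝ) 1, θ (s + 1, δ) = θ (s, δ) + 2 * Real.pi := by
    intro s δ hδ
    have h1 := hflip s δ hδ
    have h2 := hflip (s + δ) (1 - δ) ⟨by linarith [hδ.2], by linarith [hδ.1]⟩
    rw [show s + δ + (1 - δ) = s + 1 by ring, sub_sub_cancel] at h2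
    linarith
  have hperN : ∀ n : ℕ, ∀ s, ∀ δ ∈ Set.Icc (0 : ℝ) 1,
      θ (s + n, δ) = θ (s, δ) + 2 * Real.pi * n := by
    intro n s δ hδ
    induction n with
    | zero => simp
    | succ n ih =>
      rw [Nat.cast_succ, ← add_assoc, hper _ δ hδ, ih]
      ring
  obtain ⟨M, hM⟩ := (isCompact_Icc (a := (0 : ℝ)) (b := 1)).exists_bound_of_continuousOn
    (f := fun δ => θ (0, δ)) (by fun_prop)
  obtain ⟨N, hN⟩ := exists_nat_gt (M + |α₀|)
  have hπ : (1 : ℝ) < 2 * Real.pi := by linarith [Real.pi_gt_three]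
  have hN' : M + |α₀| < 2 * Real.pi * N := by
    have : (0 : ℝ) ≤ N := N.cast_nonneg
    nlinarith
  have htop : ∀ δ ∈ Set.Icc (0 : ℝ) 1, α₀ < θ (N, δ) := by
    intro δ hδ
    have h1 := hperN N 0 δ hδ
    rw [zero_add] at h1
    have h2 := (abs_le.1 (hM δ hδ)).1
    linarith [le_abs_self α₀]
  have hbot : ∀ δ ∈ Set.Icc (0 : ℝ) 1, θ (-N, δ) < α₀ := by
    intro δ hδ
    have h1 := hperN N (-N) δ hδ
    rw [neg_add_cancel] at h1
    have h2 := (abs_le.1 (hM δ hδ)).2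
    linarith [neg_abs_le α₀]
  let f₁ : ℝ → ℝ → ℝ → ℝ := fun s x y => (α₂ - α₁) - (θ (s, x + y) + Real.pi - θ (s + x, y))
  let f₂ : ℝ → ℝ → ℝ → ℝ := fun s x y => (θ (s, x + y) + Real.pi - θ (s, x)) - (α₂ - α₀)
  have hf₁ : ∀ s y, f₁ s 0 y < 0 := by
    intro s y
    simp only [f₁, zero_add, add_zero]
    linarith
  have hf₂ : ∀ s x, f₂ s x 0 < 0 := by
    intro s x
    simp only [f₂, add_zero]
    linarith
  have hf₃ : ∀ s x y, 0 ≤ x → x ≤ 1 → x + y = 1 → 0 < f₁ s x y + f₂ s x y := by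
    intro s x y hx0 hx1 hxy
    obtain rfl : y = 1 - x := by linarith
    simp only [f₁, f₂, hflip s x ⟨hx0, hx1⟩]
    linarith
  have hf₁c : Continuous fun p : ℝ × ℝ × ℝ => f₁ p.1 p.2.1 p.2.2 := by fun_prop
  have hf₂c : Continuous fun p : ℝ × ℝ × ℝ => f₂ p.1 p.2.1 p.2.2 := by fun_prop
  let Φ : ℝ × ℝ × ℝ → ℝ × ℝ × ℝ := fun p => (N * (2 * p.2.2 - 1), p.1, (1 - p.1) * p.2.1)
  have hΦ : Continuous Φ := by fun_prop
  obtain ⟨⟨X, Y, Z⟩, ⟨⟨hX0, hY0, hZ0⟩, ⟨hX1, hY1, hZ1⟩⟩, hF, hG, hH⟩ :=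
    exists_common_zero_of_cube
      (fun p => f₁ (Φ p).1 (Φ p).2.1 (Φ p).2.2)
      (fun p => f₂ (Φ p).1 (Φ p).2.1 (Φ p).2.2 + p.2.1 * f₁ (Φ p).1 (Φ p).2.1 (Φ p).2.2)
      (fun p => θ ((Φ p).1, (Φ p).2.1) - α₀)
      (hf₁c.comp hΦ) ((hf₂c.comp hΦ).add (continuous_snd.fst.mul (hf₁c.comp hΦ))) (by fun_prop)
      (fun y _ z _ => by simpa [Φ] using hf₁ _ _)
      (fun y _ z _ => by
        have h1 := hf₃ (N * (2 * z - 1)) 1 0 zero_le_one le_rfl (add_zero 1)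
        have h2 := hf₂ (N * (2 * z - 1)) 1
        simp only [Φ, sub_self, zero_mul]
        linarith)
      (fun x _ z _ => by simpa [Φ] using hf₂ _ _)
      (fun x hx z _ => by
        have h1 := hf₃ (N * (2 * z - 1)) x (1 - x) hx.1 hx.2 (add_sub_cancel x 1)
        simp only [Φ, mul_one, one_mul]
        linarith)
      (fun x hx y _ => by simpa [Φ] using hbot x hx)
      (fun x hx y _ => by
        have h1 := htop x hx
        rw [sub_pos]
        convert h1 using 3
        simp only [Φ]
        ring)
  simp only [Prod.fst_zero, Prod.snd_zero, Prod.fst_one, Prod.snd_one] at hX0 hY0 hZ0 hX1 hY1 hZ1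
  simp only [Φ] at hF hG hH
  rw [hF, mul_zero, add_zero] at hG
  set s := (N : ℝ) * (2 * Z - 1)
  have hy0 : 0 ≤ (1 - X) * Y := mul_nonneg (by linarith) hY0
  have hxy1 : X + (1 - X) * Y ≤ 1 := by nlinarith
  set y := (1 - X) * Y
  refine ⟨s, X, y, lt_of_le_of_ne hX0 ?_, lt_of_le_of_ne hy0 ?_, lt_of_le_of_ne hxy1 ?_, ?_⟩
  · intro h
    have hx : ∀ x, 0 = x → f₁ s x y < 0 := by
      rintro _ rfl
      exact hf₁ s y
    exact (hx X h).ne hF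
  · intro h
    have hy : ∀ y, 0 = y → f₂ s X y < 0 := by
      rintro _ rfl
      exact hf₂ s X
    exact (hy y h).ne hG
  · intro h
    have := hf₃ s X y hX0 hX1 h
    rw [hF, hG, add_zero] at this
    exact lt_irrefl _ this
  · simp only [f₁, f₂] at hF hG
    refine ⟨?_, ?_, ?_⟩ <;> linarith

/-- A positively oriented triangle has side directions as in `exists_chord_angles`. -/
theorem exists_side_angles (u v : ℂ) (huv : 0 < (v / u).im) :
    ∃ α₀ α₁ α₂ : ℝ, α₁ - α₀ < Real.pi ∧ α₂ - α₁ < Real.pi ∧ Real.pi < α₂ - α₀ ∧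
      u = ‖u‖ * Complex.exp (α₀ * Complex.I) ∧ v = ‖v‖ * Complex.exp (α₁ * Complex.I) ∧
      -(u + v) = ‖u + v‖ * Complex.exp (α₂ * Complex.I) := by
  have hu : u ≠ 0 := by rintro rfl; simp at huv
  have hv : v ≠ 0 := by rintro rfl; simp at huv
  have him : ∀ z : ℂ, 0 < z.im → 0 < z.arg ∧ z.arg < Real.pi := fun z hz =>
    ⟨lt_of_le_of_ne (Complex.arg_nonneg_iff.2 hz.le) fun h =>
        hz.ne' (Complex.arg_eq_zero_iff.1 h.symm).2,
      Complex.arg_lt_pi_iff.2 (Or.inr hz.ne')⟩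
  have hw : 0 < (-(u + v) / v).im := by
    have h1 : -(u + v) / v = -(v / u)⁻¹ - 1 := by field_simp; ring
    have h2 : 0 < Complex.normSq (v / u) := Complex.normSq_pos.2 (div_ne_zero hv hu)
    rw [h1, Complex.sub_im, Complex.neg_im, Complex.inv_im, Complex.one_im]
    rw [neg_div, neg_neg, sub_zero]
    positivity
  have hmul : ∀ a b : ℂ, a ≠ 0 → ∀ α : ℝ, a = ‖a‖ * Complex.exp (α * Complex.I) →
      b = ‖b‖ * Complex.exp ((α + (b / a).arg : ℝ) * Complex.I) := by
    intro a b ha α hα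
    have h1 := Complex.norm_mul_exp_arg_mul_I (b / a)
    have ha' : (‖a‖ : ℂ) ≠ 0 := by exact_mod_cast norm_ne_zero_iff.2 ha
    calc b = b / a * a := (div_mul_cancel₀ b ha).symm
      _ = (‖b / a‖ * Complex.exp ((b / a).arg * Complex.I)) *
          (‖a‖ * Complex.exp (α * Complex.I)) := by rw [h1, ← hα]
      _ = _ := by
        rw [norm_div, Complex.ofReal_add, add_mul, Complex.exp_add, Complex.ofReal_div]
        field_simp
  have e0 : u = ‖u‖ * Complex.exp (u.arg * Complex.I) := (Complex.norm_mul_exp_arg_mul_I u).symm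
  have e1 := hmul u v hu _ e0
  have e2 := hmul v (-(u + v)) hv _ e1
  rw [norm_neg] at e2
  have b1 := him _ huv
  have b2 := him _ hw
  refine ⟨_, _, _, ?_, ?_, ?_, e0, e1, e2⟩
  · linarith
  · linarith
  · by_contra! hle
    set β := u.arg + (v / u).arg + (-(u + v) / v).arg - u.arg with hβ
    have hsin : 0 ≤ Real.sin β := Real.sin_nonneg_of_nonneg_of_le_pi (by linarith) hle
    have e3 : -(u + v) / u = (‖u + v‖ / ‖u‖ : ℝ) * Complex.exp (β * Complex.I) := by
      have hu' : (‖u‖ : ℂ) ≠ 0 := by exact_mod_cast norm_ne_zero_iff.2 hu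
      rw [hβ, Complex.ofReal_sub, sub_mul, Complex.exp_sub, Complex.ofReal_div]
      conv_lhs => rw [e2]
      conv_lhs => rw [show (_ : ℂ) / u = _ / (‖u‖ * Complex.exp (u.arg * Complex.I)) by rw [← e0]]
      field_simp
    have h4 : (-(u + v) / u).im = -(v / u).im := by
      have : -(u + v) / u = -(v / u) - 1 := by field_simp; ring
      rw [this]
      simp
    rw [e3, Complex.im_ofReal_mul, Complex.exp_ofReal_mul_I_im] at h4
    have h5 : 0 ≤ ‖u + v‖ / ‖u‖ * Real.sin β := by positivity
    linarith

/-- Two triangles with the same side directions are homothetic. -/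
theorem eq_ratio_of_parallel_sides {u v : ℂ} (huv : 0 < (v / u).im) {l m n : ℝ}
    (h : (l : ℂ) * u + m * v = n * (u + v)) : l = m := by
  have hu : u ≠ 0 := by rintro rfl; simp at huv
  have h1 : ((m - n : ℝ) : ℂ) * (v / u) = ((n - l : ℝ) : ℂ) := by
    push_cast
    field_simp
    linear_combination h
  have h2 := congrArg Complex.im h1
  rw [Complex.im_ofReal_mul, Complex.ofReal_im] at h2
  have h3 : m - n = 0 := (mul_eq_zero.1 h2).resolve_right huv.ne'
  rw [h3, Complex.ofReal_zero, zero_mul] at h1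
  have h4 : n - l = 0 := by exact_mod_cast h1.symm
  linarith

/-- A curve whose chord directions admit a continuous lift as in `exists_chord_angles` inscribes
every positively oriented triangle. -/
theorem exists_inscribed_of_chord_angle (c : ℝ → ℂ) (θ : ℝ × ℝ → ℝ) (hθ : Continuous θ)
    (hflip : ∀ s, ∀ δ ∈ Set.Icc (0 : ℝ) 1, θ (s + δ, 1 - δ) = θ (s, δ) + Real.pi)
    (hc : ∀ s, ∀ δ ∈ Set.Ioo (0 : ℝ) 1,
      ∃ r : ℝ, 0 < r ∧ c (s + δ) - c s = r * Complex.exp (θ (s, δ) * Complex.I))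
    (z₀ z₁ z₂ : ℂ) (hz : 0 < ((z₂ - z₁) / (z₁ - z₀)).im) :
    ∃ a : ℝ, 0 < a ∧ ∃ b : ℂ,
      a • z₀ + b ∈ Set.range c ∧ a • z₁ + b ∈ Set.range c ∧ a • z₂ + b ∈ Set.range c := by
  set u := z₁ - z₀ with hu
  set v := z₂ - z₁ with hv
  obtain ⟨α₀, α₁, α₂, h₀₁, h₁₂, h₀₂, eu, ev, ew⟩ := exists_side_angles u v hz
  obtain ⟨s, x, y, hx, hy, hxy, ha₀, ha₁, ha₂⟩ :=
    exists_chord_angles θ hθ hflip α₀ α₁ α₂ h₀₁ h₁₂ h₀₂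
  obtain ⟨r₀, hr₀, e₀⟩ := hc s x ⟨hx, by linarith⟩
  obtain ⟨r₁, -, e₁⟩ := hc (s + x) y ⟨hy, by linarith⟩
  obtain ⟨r₂, -, e₂⟩ := hc s (x + y) ⟨by linarith, hxy⟩
  have hu0 : u ≠ 0 := by intro h; simp [h] at hz
  have hv0 : v ≠ 0 := by intro h; simp [h] at hz
  have hw0 : u + v ≠ 0 := by
    intro h
    rw [eq_neg_of_add_eq_zero_right h, neg_div, div_self hu0] at hz
    simp at hz
  have nu : (‖u‖ : ℂ) ≠ 0 := by exact_mod_cast norm_ne_zero_iff.2 hu0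
  have nv : (‖v‖ : ℂ) ≠ 0 := by exact_mod_cast norm_ne_zero_iff.2 hv0
  have nw : (‖u + v‖ : ℂ) ≠ 0 := by exact_mod_cast norm_ne_zero_iff.2 hw0
  have hθ₂ : θ (s, x + y) = α₂ - Real.pi := by linarith
  have scale : ∀ (r n : ℝ) (w E : ℂ), (n : ℂ) ≠ 0 → w = n * E → r * E = ((r / n : ℝ) : ℂ) * w := by
    rintro r n _ E hn rfl
    push_cast
    field_simp
  have f₀ : c (s + x) - c s = ((r₀ / ‖u‖ : ℝ) : ℂ) * u := by
    rw [e₀, ha₀, scale _ _ _ _ nu eu]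
  have f₁ : c (s + x + y) - c (s + x) = ((r₁ / ‖v‖ : ℝ) : ℂ) * v := by
    rw [e₁, ha₁, scale _ _ _ _ nv ev]
  have f₂ : c (s + (x + y)) - c s = ((r₂ / ‖u + v‖ : ℝ) : ℂ) * (u + v) := by
    rw [e₂, hθ₂, Complex.ofReal_sub, sub_mul, Complex.exp_sub, Complex.exp_pi_mul_I, div_neg,
      div_one, mul_neg, scale _ _ _ _ nw ew, mul_neg, neg_neg]
  set a := r₀ / ‖u‖
  have ha : 0 < a := div_pos hr₀ (norm_pos_iff.2 hu0)
  have hm : a = r₁ / ‖v‖ := by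
    refine eq_ratio_of_parallel_sides hz (n := r₂ / ‖u + v‖) ?_
    rw [← f₀, ← f₁, ← f₂, ← add_assoc]
    ring
  rw [← hm] at f₁
  refine ⟨a, ha, c s - a * z₀, ⟨s, ?_⟩, ⟨s + x, ?_⟩, ⟨s + x + y, ?_⟩⟩ <;>
    rw [Complex.real_smul]
  · ring
  · linear_combination f₀ + (a : ℂ) * hu
  · linear_combination f₀ + f₁ + (a : ℂ) * hu + (a : ℂ) * hv

/-- Version of `exists_inscribed_of_chord_angle` for triangles of arbitrary orientation. -/
theorem exists_inscribed_of_chord_angle_of_ne (c : ℝ → ℂ) (θ : ℝ × ℝ → ℝ) (hθ : Continuous θ)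
    (hflip : ∀ s, ∀ δ ∈ Set.Icc (0 : ℝ) 1, θ (s + δ, 1 - δ) = θ (s, δ) + Real.pi)
    (hc : ∀ s, ∀ δ ∈ Set.Ioo (0 : ℝ) 1,
      ∃ r : ℝ, 0 < r ∧ c (s + δ) - c s = r * Complex.exp (θ (s, δ) * Complex.I))
    (z₀ z₁ z₂ : ℂ) (hz : ((z₂ - z₁) / (z₁ - z₀)).im ≠ 0) :
    ∃ a : ℝ, 0 < a ∧ ∃ b : ℂ,
      a • z₀ + b ∈ Set.range c ∧ a • z₁ + b ∈ Set.range c ∧ a • z₂ + b ∈ Set.range c := by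
  rcases lt_or_gt_of_ne hz with h | h
  · have hv : z₂ - z₁ ≠ 0 := by intro h0; simp [h0] at h
    have h' : 0 < ((z₀ - z₁) / (z₁ - z₂)).im := by
      have e : (z₀ - z₁) / (z₁ - z₂) = ((z₂ - z₁) / (z₁ - z₀))⁻¹ := by
        rw [inv_div, ← neg_sub z₁ z₀, ← neg_sub z₂ z₁, neg_div_neg_eq]
      rw [e, Complex.inv_im]
      have hne : (z₂ - z₁) / (z₁ - z₀) ≠ 0 := by intro h0; simp [h0] at h
      exact div_pos (neg_pos.2 h) (Complex.normSq_pos.2 hne)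
    obtain ⟨a, ha, b, h₂, h₁, h₀⟩ := exists_inscribed_of_chord_angle c θ hθ hflip hc z₂ z₁ z₀ h'
    exact ⟨a, ha, b, h₀, h₁, h₂⟩
  · exact exists_inscribed_of_chord_angle c θ hθ hflip hc z₀ z₁ z₂ h

/-- The slope `(c (s + δ) - c s) / δ` at `p = (s, δ)`, extended by the derivative to `δ = 0`. -/
noncomputable def chordSlope (c : ℝ → ℂ) (p : ℝ × ℝ) : ℂ :=
  ∫ x in (0 : ℝ)..1, deriv c (p.1 + x * p.2)

theorem continuous_chordSlope {c : ℝ → ℂ} (hc : ContDiff ℝ 1 c) : Continuous (chordSlope c) := by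
  have h : Continuous (deriv c) := hc.continuous_deriv le_rfl
  unfold chordSlope
  apply intervalIntegral.continuous_parametric_intervalIntegral_of_continuous'
  fun_prop

theorem mul_chordSlope {c : ℝ → ℂ} (hc : ContDiff ℝ 1 c) (s δ : ℝ) :
    δ * chordSlope c (s, δ) = c (s + δ) - c s := by
  have h : Continuous (deriv c) := hc.continuous_deriv le_rfl
  have hd : ∀ x ∈ Set.uIcc (0 : ℝ) 1,
      HasDerivAt (fun x => c (s + x * δ)) (δ * deriv c (s + x * δ)) x := by
    intro x _
    have h1 : HasDerivAt (fun x : ℝ => s + x * δ) δ x := by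
      simpa using ((hasDerivAt_id x).mul_const δ).const_add s
    have h2 := ((hc.differentiable one_ne_zero) (s + x * δ)).hasDerivAt
    have h3 := HasDerivAt.scomp x h2 h1
    rwa [Complex.real_smul] at h3
  have h4 := intervalIntegral.integral_eq_sub_of_hasDerivAt hd
    (Continuous.intervalIntegrable (by fun_prop) _ _)
  rw [intervalIntegral.integral_const_mul] at h4
  simpa [chordSlope] using h4

theorem chordSlope_zero (c : ℝ → ℂ) (s : ℝ) : chordSlope c (s, 0) = deriv c s := by
  simp [chordSlope]

theorem chordSlope_add_one {c : ℝ → ℂ} (hper : Function.Periodic c 1) (s δ : ℝ) :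
    chordSlope c (s + 1, δ) = chordSlope c (s, δ) := by
  have h : ∀ t, deriv c (t + 1) = deriv c t := by
    intro t
    rw [← deriv_comp_add_const]
    congr 1
    exact funext hper
  simp only [chordSlope]
  congr 1
  ext x
  rw [← h (s + x * δ), add_right_comm]

/-- The chord of a curve of period one from `s` to `s + δ`, rescaled by `δ * (1 - δ)` so that it
extends to nonzero tangent vectors at `δ = 0` and `δ = 1`. -/
noncomputable def rescaledChord (c : ℝ → ℂ) (p : ℝ × ℝ) : ℂ :=
  chordSlope c p - chordSlope c (p.1 + p.2, 1 - p.2)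

theorem continuous_rescaledChord {c : ℝ → ℂ} (hc : ContDiff ℝ 1 c) :
    Continuous (rescaledChord c) := by
  have := continuous_chordSlope hc
  unfold rescaledChord
  fun_prop

theorem mul_rescaledChord {c : ℝ → ℂ} (hc : ContDiff ℝ 1 c) (hper : Function.Periodic c 1)
    (s δ : ℝ) : ((δ * (1 - δ) : ℝ) : ℂ) * rescaledChord c (s, δ) = c (s + δ) - c s := by
  have h1 := mul_chordSlope hc s δ
  have h2 := mul_chordSlope hc (s + δ) (1 - δ)
  rw [show s + δ + (1 - δ) = s + 1 by ring, hper s] at h2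
  simp only [rescaledChord]
  push_cast at h2 ⊢
  linear_combination (1 - (δ : ℂ)) * h1 - (δ : ℂ) * h2

theorem rescaledChord_flip {c : ℝ → ℂ} (hper : Function.Periodic c 1) (s δ : ℝ) :
    rescaledChord c (s + δ, 1 - δ) = -rescaledChord c (s, δ) := by
  simp only [rescaledChord]
  rw [show s + δ + (1 - δ) = s + 1 by ring, sub_sub_cancel, chordSlope_add_one hper, neg_sub]

theorem ne_of_periodic_of_injOn {c : ℝ → ℂ} (hper : Function.Periodic c 1)
    (hinj : Set.InjOn c (Set.Ico 0 1)) (s : ℝ) {δ : ℝ} (hδ : δ ∈ Set.Ioo (0 : ℝ) 1) :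
    c (s + δ) ≠ c s := by
  intro h
  have hfract : ∀ t, c (Int.fract t) = c t := fun t => by
    have := hper.sub_int_mul_eq (x := t) ⌊t⌋
    rwa [mul_one] at this
  rw [← hfract (s + δ), ← hfract s] at h
  obtain ⟨n, hn⟩ := Int.fract_eq_fract.1 (hinj ⟨Int.fract_nonneg _, Int.fract_lt_one _⟩
    ⟨Int.fract_nonneg _, Int.fract_lt_one _⟩ h)
  rw [add_sub_cancel_left] at hn
  have h0 : (0 : ℝ) < n := hn ▸ hδ.1
  have h1 : (n : ℝ) < 1 := hn ▸ hδ.2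
  norm_cast at h0 h1
  omega

theorem rescaledChord_ne_zero {c : ℝ → ℂ} (hc : ContDiff ℝ 1 c) (hper : Function.Periodic c 1)
    (hinj : Set.InjOn c (Set.Ico 0 1)) (himm : ∀ t, deriv c t ≠ 0) (s : ℝ) {δ : ℝ}
    (hδ : δ ∈ Set.Icc (0 : ℝ) 1) : rescaledChord c (s, δ) ≠ 0 := by
  have hzero : ∀ s, rescaledChord c (s, 0) ≠ 0 := by
    intro s
    have h1 := mul_chordSlope hc s 1
    rw [hper s, sub_self, Complex.ofReal_one, one_mul] at h1
    simpa [rescaledChord, chordSlope_zero, h1] using himm s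
  rcases hδ.1.eq_or_lt with rfl | h0
  · exact hzero s
  rcases hδ.2.eq_or_lt with rfl | h1
  · have h2 := rescaledChord_flip hper s 0
    rw [add_zero, sub_zero] at h2
    rw [h2]
    exact neg_ne_zero.2 (hzero s)
  · intro h
    have h2 := mul_rescaledChord hc hper s δ
    rw [h, mul_zero] at h2
    exact ne_of_periodic_of_injOn hper hinj s ⟨h0, h1⟩ (sub_eq_zero.1 h2.symm)

/-- Continuous choice of an angle for a nowhere vanishing function on the plane. -/
theorem exists_continuous_angle (F : ℝ × ℝ → ℂ) (hF : Continuous F) (hF0 : ∀ p, F p ≠ 0) :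
    ∃ θ : ℝ × ℝ → ℝ, Continuous θ ∧ ∀ p, F p = ‖F p‖ * Complex.exp (θ p * Complex.I) := by
  let f : C(ℝ × ℝ, ℂ) := ⟨F, hF⟩
  obtain ⟨L, ⟨-, hL⟩, -⟩ := Complex.isCoveringMapOn_exp.existsUnique_continuousMap_lifts f
    (a₀ := 0) (Complex.exp_log (hF0 0)) hF0
  refine ⟨fun p => (L p).im, Complex.continuous_im.comp L.continuous, fun p => ?_⟩
  have h : Complex.exp (L p) = F p := congrFun hL p
  rw [← h, Complex.norm_exp, Complex.ofReal_exp, ← Complex.exp_add, Complex.re_add_im]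

/-- Two continuous angles whose difference is pointwise an odd multiple of `π` differ by a
constant. -/
theorem angle_sub_eq_of_exp_eq_neg (θ₁ θ₂ : ℝ × ℝ → ℝ) (h₁ : Continuous θ₁) (h₂ : Continuous θ₂)
    (h : ∀ p, Complex.exp (θ₁ p * Complex.I) = -Complex.exp (θ₂ p * Complex.I)) (p q : ℝ × ℝ) :
    θ₁ p - θ₂ p = θ₁ q - θ₂ q := by
  have hd : ∀ p, Circle.exp (θ₁ p - θ₂ p) = Circle.exp Real.pi := by
    intro p
    ext
    rw [Circle.coe_exp, Circle.coe_exp, Complex.ofReal_sub, sub_mul, Complex.exp_sub, h p,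
      neg_div, div_self (Complex.exp_ne_zero _), Complex.exp_pi_mul_I]
  have := Circle.isCoveringMap_exp.eq_of_comp_eq (g₁ := fun p => θ₁ p - θ₂ p)
    (g₂ := fun _ => θ₁ q - θ₂ q) (by fun_prop) (by fun_prop)
    (funext fun p => (hd p).trans (hd q).symm) q rfl
  exact congrFun this p

/-- An angle that stays in the upper half plane increases by at most `π`. -/
theorem angle_le_add_pi (φ : ℝ → ℝ) (hφ : Continuous φ)
    (h : ∀ t ∈ Set.Ioo (0 : ℝ) 1, 0 ≤ Real.sin (φ t)) : φ 1 ≤ φ 0 + Real.pi := by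
  by_contra! hlt
  have hsin : ∀ x ∈ Set.Ioo (φ 0) (φ 1), 0 ≤ Real.sin x := by
    intro x hx
    obtain ⟨t, ht, rfl⟩ := intermediate_value_Ioo zero_le_one hφ.continuousOn hx
    exact h t ht
  have hπ := Real.pi_pos
  have hzero : ∀ x, φ 0 < x → x + Real.pi < φ 1 → Real.sin x = 0 := by
    intro x h0 h1
    have h2 := hsin x ⟨h0, by linarith⟩
    have h3 := hsin (x + Real.pi) ⟨by linarith, h1⟩
    rw [Real.sin_add_pi] at h3
    linarith
  set e := min Real.pi (φ 1 - φ 0 - Real.pi)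
  have he0 : 0 < e := lt_min hπ (by linarith)
  have he1 : e ≤ Real.pi := min_le_left _ _
  have he2 : e ≤ φ 1 - φ 0 - Real.pi := min_le_right _ _
  have ha := hzero (φ 0 + e / 3) (by linarith) (by linarith)
  have hb := hzero (φ 0 + e / 3 + e / 3) (by linarith) (by linarith)
  rw [Real.sin_add, ha, zero_mul, zero_add, mul_eq_zero] at hb
  rcases hb with hb | hb
  · have := Real.sin_sq_add_cos_sq (φ 0 + e / 3)
    rw [ha, hb] at this
    norm_num at this
  · exact (Real.sin_pos_of_pos_of_lt_pi (by linarith) (by linarith)).ne' hb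

/-- Hopf's Umlaufsatz, in terms of chords: the directions of the chords of a simple closed
`C¹` curve admit a continuous angle which changes by `π` or `-π`, according to the orientation,
when a chord is reversed. -/
theorem exists_chord_angle {c : ℝ → ℂ} (hc : ContDiff ℝ 1 c) (hper : Function.Periodic c 1)
    (hinj : Set.InjOn c (Set.Ico 0 1)) (himm : ∀ t, deriv c t ≠ 0) :
    ∃ (θ : ℝ × ℝ → ℝ) (k : ℝ), Continuous θ ∧ (k = Real.pi ∨ k = -Real.pi) ∧
      (∀ s, ∀ δ ∈ Set.Icc (0 : ℝ) 1, θ (s + δ, 1 - δ) = θ (s, δ) + k) ∧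
      ∀ s, ∀ δ ∈ Set.Ioo (0 : ℝ) 1,
        ∃ r : ℝ, 0 < r ∧ c (s + δ) - c s = r * Complex.exp (θ (s, δ) * Complex.I) := by
  let clamp : ℝ → ℝ := fun δ => max 0 (min 1 δ)
  have hcmem : ∀ δ, clamp δ ∈ Set.Icc (0 : ℝ) 1 := fun δ =>
    ⟨le_max_left _ _, max_le zero_le_one (min_le_left _ _)⟩
  have hceq : ∀ δ ∈ Set.Icc (0 : ℝ) 1, clamp δ = δ := fun δ hδ => by
    simp only [clamp, min_eq_right hδ.2, max_eq_right hδ.1]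
  have hG := continuous_rescaledChord hc
  have hG0 : ∀ s, ∀ δ ∈ Set.Icc (0 : ℝ) 1, rescaledChord c (s, δ) ≠ 0 := fun s δ hδ =>
    rescaledChord_ne_zero hc hper hinj himm s hδ
  obtain ⟨θ, hθ, hexp⟩ := exists_continuous_angle (fun p => rescaledChord c (p.1, clamp p.2))
    (by fun_prop) (fun p => hG0 _ _ (hcmem _))
  have hexp' : ∀ s, ∀ δ ∈ Set.Icc (0 : ℝ) 1, rescaledChord c (s, δ) =
      ‖rescaledChord c (s, δ)‖ * Complex.exp (θ (s, δ) * Complex.I) := by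
    intro s δ hδ
    simpa only [hceq δ hδ] using hexp (s, δ)
  have hneg : ∀ s, ∀ δ ∈ Set.Icc (0 : ℝ) 1, Complex.exp (θ (s + δ, 1 - δ) * Complex.I) =
      -Complex.exp (θ (s, δ) * Complex.I) := by
    intro s δ hδ
    have h1 := hexp' s δ hδ
    have h2 := hexp' (s + δ) (1 - δ) ⟨by linarith [hδ.2], by linarith [hδ.1]⟩
    have hn : (‖rescaledChord c (s, δ)‖ : ℂ) ≠ 0 := by
      exact_mod_cast norm_ne_zero_iff.2 (hG0 s δ hδ)
    rw [rescaledChord_flip hper, norm_neg] at h2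
    apply mul_left_cancel₀ hn
    rw [← h2, mul_neg, ← h1]
  have hconst := angle_sub_eq_of_exp_eq_neg
    (fun p => θ (p.1 + clamp p.2, 1 - clamp p.2)) (fun p => θ (p.1, clamp p.2))
    (by fun_prop) (by fun_prop) (fun p => hneg _ _ (hcmem _))
  -- at a lowest point of the curve all chords point upwards
  obtain ⟨s₀, -, hmin⟩ := (isCompact_Icc (a := (0 : ℝ)) (b := 1)).exists_isMinOn
    (f := fun t => (c t).im) ⟨0, by simp⟩
    (Complex.continuous_im.comp hc.continuous).continuousOn
  have hlow : ∀ t, (c s₀).im ≤ (c t).im := by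
    intro t
    obtain ⟨t', ht', h⟩ := hper.exists_mem_Ico₀ one_pos t
    rw [h]
    exact isMinOn_iff.1 hmin t' ⟨ht'.1, ht'.2.le⟩
  have hchord : ∀ s, ∀ δ ∈ Set.Ioo (0 : ℝ) 1, ∃ r : ℝ, 0 < r ∧
      c (s + δ) - c s = r * Complex.exp (θ (s, δ) * Complex.I) := by
    intro s δ hδ
    have hδ' : δ ∈ Set.Icc (0 : ℝ) 1 := ⟨hδ.1.le, hδ.2.le⟩
    refine ⟨δ * (1 - δ) * ‖rescaledChord c (s, δ)‖, ?_, ?_⟩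
    · exact mul_pos (mul_pos hδ.1 (by linarith [hδ.2])) (norm_pos_iff.2 (hG0 s δ hδ'))
    · rw [← mul_rescaledChord hc hper s δ, Complex.ofReal_mul _ ‖_‖, mul_assoc, ← hexp' s δ hδ']
  have hsin : ∀ δ ∈ Set.Ioo (0 : ℝ) 1, 0 ≤ Real.sin (θ (s₀, δ)) := by
    intro δ hδ
    obtain ⟨r, hr, h⟩ := hchord s₀ δ hδ
    have h1 := congrArg Complex.im h
    rw [Complex.im_ofReal_mul, Complex.exp_ofReal_mul_I_im, Complex.sub_im] at h1
    have h2 : 0 ≤ r * Real.sin (θ (s₀, δ)) := h1 ▸ sub_nonneg.2 (hlow _)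
    exact nonneg_of_mul_nonneg_right h2 hr
  have hle := angle_le_add_pi (fun δ => θ (s₀, δ)) (by fun_prop) hsin
  have hge := angle_le_add_pi (fun δ => θ (s₀, 1 - δ)) (by fun_prop)
    (fun δ hδ => hsin _ ⟨by linarith [hδ.2], by linarith [hδ.1]⟩)
  simp only [sub_self, sub_zero] at hge
  have hk := hneg s₀ 0 ⟨le_rfl, zero_le_one⟩
  rw [add_zero, sub_zero] at hk
  set k := θ (s₀, 1) - θ (s₀, 0) with hk_def
  refine ⟨θ, k, hθ, ?_, ?_, hchord⟩
  · have hcos : Real.cos k = -1 := by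
      have h1 : Complex.exp (k * Complex.I) = -1 := by
        rw [hk_def, Complex.ofReal_sub, sub_mul, Complex.exp_sub, hk, neg_div,
          div_self (Complex.exp_ne_zero _)]
      rw [← Complex.exp_ofReal_mul_I_re, h1, Complex.neg_re, Complex.one_re]
    have habs : |k| = Real.pi := by
      apply Real.injOn_cos ⟨abs_nonneg k, abs_le.2 ⟨by linarith, by linarith⟩⟩
        ⟨Real.pi_pos.le, le_rfl⟩
      rw [Real.cos_abs, hcos, Real.cos_pi]
    exact eq_or_eq_neg_of_abs_eq habs
  · intro s δ hδ
    have h := hconst (s, δ) (s₀, 0)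
    simp only [hceq δ hδ, hceq 0 ⟨le_rfl, zero_le_one⟩, add_zero, sub_zero] at h
    linarith

theorem im_ne_zero_of_not_collinear {z₀ z₁ z₂ : ℂ}
    (h : ¬ Collinear ℝ ({z₀, z₁, z₂} : Set ℂ)) : ((z₂ - z₁) / (z₁ - z₀)).im ≠ 0 := by
  contrapose! h
  by_cases h10 : z₁ = z₀
  · subst h10
    simpa using collinear_pair ℝ z₁ z₂
  have hne : z₁ - z₀ ≠ 0 := sub_ne_zero.2 h10
  rw [collinear_iff_of_mem (Set.mem_insert z₀ _)]
  refine ⟨z₁ - z₀, ?_⟩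
  have hr : (z₂ - z₁) / (z₁ - z₀) = (((z₂ - z₁) / (z₁ - z₀)).re : ℂ) :=
    Complex.ext (by simp) (by simpa using h)
  rw [div_eq_iff hne] at hr
  simp only [Set.mem_insert_iff, Set.mem_singleton_iff, forall_eq_or_imp, forall_eq,
    vadd_eq_add, Complex.real_smul]
  refine ⟨⟨0, by simp⟩, ⟨1, by simp⟩, ⟨((z₂ - z₁) / (z₁ - z₀)).re + 1, ?_⟩⟩
  push_cast
  linear_combination hr

open ComplexConjugate in
/-- Inscribing a triangle in a curve is equivalent to inscribing its reflection in the reflected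
curve. -/
theorem exists_inscribed_of_conj {c : ℝ → ℂ} {z₀ z₁ z₂ : ℂ}
    (h : ∃ a : ℝ, 0 < a ∧ ∃ b : ℂ, a • conj z₀ + b ∈ Set.range (fun t => conj (c t)) ∧
      a • conj z₁ + b ∈ Set.range (fun t => conj (c t)) ∧
      a • conj z₂ + b ∈ Set.range (fun t => conj (c t))) :
    ∃ a : ℝ, 0 < a ∧ ∃ b : ℂ,
      a • z₀ + b ∈ Set.range c ∧ a • z₁ + b ∈ Set.range c ∧ a • z₂ + b ∈ Set.range c := by
  obtain ⟨a, ha, b, ⟨t₀, h₀⟩, ⟨t₁, h₁⟩, ⟨t₂, h₂⟩⟩ := h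
  have hback : ∀ z t, conj (c t) = a • conj z + b → c t = a • z + conj b := by
    intro z t h
    have := congrArg conj h
    rwa [Complex.conj_conj, map_add, Complex.real_smul, map_mul, Complex.conj_ofReal,
      Complex.conj_conj, ← Complex.real_smul] at this
  exact ⟨a, ha, conj b, ⟨t₀, hback _ _ h₀⟩, ⟨t₁, hback _ _ h₁⟩, ⟨t₂, hback _ _ h₂⟩⟩

/-- **Main theorem.**  Let `Γ` be a Jordan `C¹`-curve in the plane, i.e. the image of an
injective `C¹` immersion of the circle (realized as a `1`-periodic `C¹` map `ℝ → ℂ`,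
injective on `[0,1)`, with nowhere vanishing derivative).  Then any non-flat triangle
`(z₀,z₁,z₂)` may be transformed, by a translation and a homothety with positive ratio,
into a triangle whose vertices lie on `Γ`. -/
theorem stmt_18 (Γ : Set ℂ) (c : ℝ → ℂ) (hc : ContDiff ℝ 1 c)
    (hper : Function.Periodic c 1) (hinj : Set.InjOn c (Set.Ico 0 1))
    (himm : ∀ t, deriv c t ≠ 0) (hΓ : Γ = Set.range c)
    (z₀ z₁ z₂ : ℂ) (hnf : ¬ Collinear ℝ ({z₀, z₁, z₂} : Set ℂ)) :
    ∃ a : ℝ, 0 < a ∧ ∃ b : ℂ,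
      a • z₀ + b ∈ Γ ∧ a • z₁ + b ∈ Γ ∧ a • z₂ + b ∈ Γ := by
  subst hΓ
  have him := im_ne_zero_of_not_collinear hnf
  obtain ⟨θ, k, hθ, hk, hflip, hchord⟩ := exists_chord_angle hc hper hinj himm
  rcases hk with rfl | rfl
  · exact exists_inscribed_of_chord_angle_of_ne c θ hθ hflip hchord z₀ z₁ z₂ him
  refine exists_inscribed_of_conj (exists_inscribed_of_chord_angle_of_ne _ (fun p => -θ p) hθ.neg
    (fun s δ hδ => by rw [hflip s δ hδ, neg_add, neg_neg]) (fun s δ hδ => ?_) _ _ _ ?_)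
  · obtain ⟨r, hr, h⟩ := hchord s δ hδ
    refine ⟨r, hr, ?_⟩
    rw [← map_sub, h, map_mul, Complex.conj_ofReal, ← Complex.exp_conj, map_mul,
      Complex.conj_ofReal, Complex.conj_I, Complex.ofReal_neg, mul_neg, neg_mul]
  · rw [← map_sub, ← map_sub, ← map_div₀, Complex.conj_im]
    exact neg_ne_zero.2 him
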